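/- Define the defect ratio ρ(n) = d(n)/n². Along the sequence n_r = (2r+1)!/2, the defect ratio tends to zero: ρ(n_r) ≤ (2·(2r)!!/(2r+1)!)² for all r ≥ 3, and lim_{r→∞} ρ(n_r) = 0, where (2r)!! = 2r(2r−2)···2. -/

import Mathlib

/-- An axis-aligned rectangle with integer coordinates placed on the grid:
lower-left corner `(x, y)`, width `w`, and height `h`. -/
structure Rect where
  x : ℕ
  y : ℕ
  w : ℕ
  h : ℕ
deriving DecidableEq

/-- The area of a rectangle. -/
def Rect.area (r : Rect) : ℕ := r.w * r.h

/-- Two rectangles are congruent if they have the same dimensions,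
possibly after a ninety-degree rotation. -/
def Rect.Congruent (r s : Rect) : Prop :=
  (r.w = s.w ∧ r.h = s.h) ∨ (r.w = s.h ∧ r.h = s.w)

/-- The rectangle `r` covers the unit grid cell `[i, i+1) × [j, j+1)`. -/
def Rect.Covers (r : Rect) (i j : ℕ) : Prop :=
  r.x ≤ i ∧ i < r.x + r.w ∧ r.y ≤ j ∧ j < r.y + r.h

/-- A Mondrian partition of the `n × n` square: a finite collection of
pairwise non-congruent rectangles with positive integer side lengths that
tile the square (every cell of the square is covered by exactly one
rectangle, and rectangles lie inside the square). -/
structure Mondrian (n : ℕ) where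
  rects : Finset Rect
  pos : ∀ r ∈ rects, 0 < r.w ∧ 0 < r.h
  inside : ∀ r ∈ rects, r.x + r.w ≤ n ∧ r.y + r.h ≤ n
  cover : ∀ i j : ℕ, i < n → j < n → ∃! r : Rect, r ∈ rects ∧ r.Covers i j
  noncong : ∀ r ∈ rects, ∀ s ∈ rects, r ≠ s → ¬ r.Congruent s

/-- The defect of a Mondrian partition: the difference between the largest
and the smallest rectangle areas. -/
def Mondrian.defect {n : ℕ} (P : Mondrian n) : ℕ :=
  P.rects.sup fun r => P.rects.sup fun s => r.area - s.area

/-- A Mondrian partition is perfect if all its rectangles have the same area. -/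
def Mondrian.IsPerfect {n : ℕ} (P : Mondrian n) : Prop :=
  ∀ r ∈ P.rects, ∀ s ∈ P.rects, r.area = s.area

/-- `mondrianDk n k` is the minimum defect over all Mondrian partitions of the
`n × n` square using exactly `k` rectangles. -/
noncomputable def mondrianDk (n k : ℕ) : ℕ :=
  sInf {d | ∃ P : Mondrian n, P.rects.card = k ∧ P.defect = d}

/-- `mondrianD n` is the minimum defect over all Mondrian partitions of the
`n × n` square (into at least two rectangles). -/
noncomputable def mondrianD (n : ℕ) : ℕ :=
  sInf {d | ∃ P : Mondrian n, 2 ≤ P.rects.card ∧ P.defect = d}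

/-- The defect ratio `ρ(n) = d(n) / n²`. -/
noncomputable def mondrianRho (n : ℕ) : ℝ := (mondrianD n : ℝ) / (n : ℝ) ^ 2

/-- The rectangles in `S` tile the `W × H` rectangle with lower-left corner at the origin. -/
structure IsTiling (S : Finset Rect) (W H : ℕ) : Prop where
  pos : ∀ r ∈ S, 0 < r.w ∧ 0 < r.h
  inside : ∀ r ∈ S, r.x + r.w ≤ W ∧ r.y + r.h ≤ H
  cover : ∀ i j : ℕ, i < W → j < H → ∃! r : Rect, r ∈ S ∧ r.Covers i j

theorem isTiling_empty (W : ℕ) : IsTiling ∅ W 0 := ⟨by simp, by simp, by simp⟩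

theorem IsTiling.attach_top {S : Finset Rect} {W H h : ℕ} (hS : IsTiling S W H) (hW : 0 < W)
    (hh : 0 < h) : IsTiling (insert ⟨0, H, W, h⟩ S) W (H + h) := by
  refine ⟨fun r hr => ?_, fun r hr => ?_, fun i j hi hj => ?_⟩
  · rcases Finset.mem_insert.1 hr with rfl | hr
    · exact ⟨hW, hh⟩
    · exact hS.pos r hr
  · rcases Finset.mem_insert.1 hr with rfl | hr
    · simp
    · have := hS.inside r hr
      omega
  · by_cases hjH : j < H
    · obtain ⟨r, ⟨hr, hc⟩, hu⟩ := hS.cover i j hi hjH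
      refine ⟨r, ⟨Finset.mem_insert_of_mem hr, hc⟩, fun s ⟨hs, hsc⟩ => ?_⟩
      rcases Finset.mem_insert.1 hs with rfl | hs
      · simp only [Rect.Covers] at hsc
        omega
      · exact hu s ⟨hs, hsc⟩
    · refine ⟨⟨0, H, W, h⟩, ⟨Finset.mem_insert_self _ _, ?_⟩, fun s ⟨hs, hsc⟩ => ?_⟩
      · simp only [Rect.Covers]
        omega
      · rcases Finset.mem_insert.1 hs with rfl | hs
        · rfl
        · have := hS.inside s hs
          simp only [Rect.Covers] at hsc
          omega

theorem IsTiling.attach_right {S : Finset Rect} {W H w : ℕ} (hS : IsTiling S W H) (hH : 0 < H)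
    (hw : 0 < w) : IsTiling (insert ⟨W, 0, w, H⟩ S) (W + w) H := by
  refine ⟨fun r hr => ?_, fun r hr => ?_, fun i j hi hj => ?_⟩
  · rcases Finset.mem_insert.1 hr with rfl | hr
    · exact ⟨hw, hH⟩
    · exact hS.pos r hr
  · rcases Finset.mem_insert.1 hr with rfl | hr
    · simp
    · have := hS.inside r hr
      omega
  · by_cases hiW : i < W
    · obtain ⟨r, ⟨hr, hc⟩, hu⟩ := hS.cover i j hiW hj
      refine ⟨r, ⟨Finset.mem_insert_of_mem hr, hc⟩, fun s ⟨hs, hsc⟩ => ?_⟩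
      rcases Finset.mem_insert.1 hs with rfl | hs
      · simp only [Rect.Covers] at hsc
        omega
      · exact hu s ⟨hs, hsc⟩
    · refine ⟨⟨W, 0, w, H⟩, ⟨Finset.mem_insert_self _ _, ?_⟩, fun s ⟨hs, hsc⟩ => ?_⟩
      · simp only [Rect.Covers]
        omega
      · rcases Finset.mem_insert.1 hs with rfl | hs
        · rfl
        · have := hS.inside s hs
          simp only [Rect.Covers] at hsc
          omega

/-- Two stacked rectangles, extended alternately on the right and on the top, tile a rectangle. -/
theorem exists_staircase_tiling {W H a b : ℕ → ℕ} {m p q : ℕ} (hW0 : 0 < W 0) (hp : 0 < p)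
    (hq : 0 < q) (hH0 : H 0 = p + q) (ha : ∀ j ≤ m, 0 < a j) (hb : ∀ j < m, 0 < b j)
    (hW : ∀ j ≤ m, W (j + 1) = W j + a j) (hH : ∀ j < m, H (j + 1) = H j + b j) :
    ∃ S : Finset Rect, IsTiling S (W (m + 1)) (H m) ∧
      ∀ s, s ∈ S ↔ s = ⟨0, 0, W 0, p⟩ ∨ s = ⟨0, p, W 0, q⟩ ∨
        (∃ i ≤ m, s = ⟨W i, 0, a i, H i⟩) ∨ ∃ i < m, s = ⟨0, H i, W (i + 1), b i⟩ := by
  induction m with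
  | zero =>
    have h1 := (isTiling_empty (W 0)).attach_top hW0 hp
    have h2 := h1.attach_top hW0 hq
    simp only [zero_add] at h2
    rw [← hH0] at h2
    have h3 := h2.attach_right (by omega) (ha 0 le_rfl)
    rw [← hW 0 le_rfl] at h3
    refine ⟨_, h3, fun s => ?_⟩
    simp only [Finset.mem_insert, Finset.notMem_empty, nonpos_iff_eq_zero, exists_eq_left,
      not_lt_zero, false_and, exists_false, or_false]
    tauto
  | succ k ih =>
    obtain ⟨S, hS, hmem⟩ := ih (fun j hj => ha j (by omega)) (fun j hj => hb j (by omega))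
      (fun j hj => hW j (by omega)) (fun j hj => hH j (by omega))
    have hWpos : 0 < W (k + 1) := by
      have := hW k (by omega)
      have := ha k (by omega)
      omega
    have h2 := hS.attach_top hWpos (hb k (by omega))
    rw [← hH k (by omega)] at h2
    have h3 := h2.attach_right
      (by have := hH k (by omega); have := hb k (by omega); omega) (ha (k + 1) le_rfl)
    rw [← hW (k + 1) le_rfl] at h3
    refine ⟨_, h3, fun s => ?_⟩
    simp only [Finset.mem_insert, hmem, Nat.lt_succ_iff_lt_or_eq, Nat.le_add_one_iff, or_and_right,
      exists_or, exists_eq_left]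
    apply Eq.to_iff
    ac_rfl

theorem Rect.Congruent.area_eq {r s : Rect} (h : r.Congruent s) : r.area = s.area := by
  unfold Rect.area
  rcases h with ⟨h1, h2⟩ | ⟨h1, h2⟩
  · rw [h1, h2]
  · rw [h1, h2, mul_comm]

theorem Rect.Congruent.symm {r s : Rect} (h : r.Congruent s) : s.Congruent r := by
  unfold Rect.Congruent at *
  omega

/-- A staircase whose attached rectangles all have area `A` is a Mondrian partition as soon as the
two initial rectangles have other areas and the sides satisfy suitable inequalities. -/
theorem exists_mondrian_of_staircase {W H a b : ℕ → ℕ} {m p q n A D : ℕ} (hW0 : 0 < W 0)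
    (hq : 0 < q) (hH0 : H 0 = p + q) (ha : ∀ j ≤ m, 0 < a j) (hb : ∀ j < m, 0 < b j)
    (hW : ∀ j ≤ m, W (j + 1) = W j + a j) (hH : ∀ j < m, H (j + 1) = H j + b j)
    (hWn : W (m + 1) = n) (hHn : H m = n)
    (haA : ∀ j ≤ m, a j * H j = A) (hbA : ∀ j < m, W (j + 1) * b j = A)
    (hpA : A < W 0 * p) (hqA : W 0 * q < A) (hD : W 0 * p - W 0 * q ≤ D)
    (hWA : A < W 0 * W 0) (hHA : A < H 0 * H 0)
    (hne : ∀ i < m, ∀ j ≤ m, W (i + 1) ≠ H j) : mondrianD n ≤ D := by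
  have hp : 0 < p := Nat.pos_of_ne_zero (by rintro rfl; omega)
  obtain ⟨S, hS, hmem⟩ := exists_staircase_tiling hW0 hp hq hH0 ha hb hW hH
  rw [hWn, hHn] at hS
  have hWmono : ∀ j ≤ m + 1, ∀ i < j, W i < W j := by
    intro j
    induction j with
    | zero => intro _ i hi; omega
    | succ j ih =>
      intro hj i hi
      have h1 := hW j (by omega)
      have h2 := ha j (by omega)
      rcases Nat.lt_succ_iff_lt_or_eq.1 hi with h | rfl
      · have := ih (by omega) i h
        omega
      · omega
  have hHmono : ∀ j ≤ m, ∀ i < j, H i < H j := by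
    intro j
    induction j with
    | zero => intro _ i hi; omega
    | succ j ih =>
      intro hj i hi
      have h1 := hH j (by omega)
      have h2 := hb j (by omega)
      rcases Nat.lt_succ_iff_lt_or_eq.1 hi with h | rfl
      · have := ih (by omega) i h
        omega
      · omega
  have hWge : ∀ j ≤ m + 1, W 0 ≤ W j := fun j hj => by
    rcases Nat.eq_zero_or_pos j with rfl | h
    · exact le_rfl
    · exact (hWmono j hj 0 h).le
  have hHge : ∀ j ≤ m, H 0 ≤ H j := fun j hj => by
    rcases Nat.eq_zero_or_pos j with rfl | h
    · exact le_rfl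
    · exact (hHmono j hj 0 h).le
  have hright_top : ∀ j ≤ m, ∀ i < m,
      ¬ (⟨W j, 0, a j, H j⟩ : Rect).Congruent ⟨0, H i, W (i + 1), b i⟩ := by
    rintro j hj i hi (⟨h1, -⟩ | ⟨-, h2⟩)
    · simp only at h1
      have h3 := haA j hj
      have h4 : W 0 * H 0 ≤ A := by
        rw [← h3, h1]
        exact Nat.mul_le_mul (hWge _ (by omega)) (hHge j hj)
      have h5 : W 0 * p ≤ W 0 * H 0 := Nat.mul_le_mul_left _ (by omega)
      omega
    · exact hne i hi j hj h2.symm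
  have hareas : ∀ s ∈ S, W 0 * q ≤ s.area ∧ s.area ≤ W 0 * p := by
    intro s hs
    rcases (hmem s).1 hs with rfl | rfl | ⟨i, hi, rfl⟩ | ⟨i, hi, rfl⟩
    · simp only [Rect.area]; omega
    · simp only [Rect.area]; omega
    · simp only [Rect.area, haA i hi]; omega
    · simp only [Rect.area, hbA i hi]; omega
  let P : Mondrian n :=
    { rects := S
      pos := hS.pos
      inside := hS.inside
      cover := hS.cover
      noncong := by
        intro r hr s hs hrs hc
        have harea := hc.area_eq
        rcases (hmem r).1 hr with rfl | rfl | ⟨i, hi, rfl⟩ | ⟨i, hi, rfl⟩ <;>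
        rcases (hmem s).1 hs with rfl | rfl | ⟨j, hj, rfl⟩ | ⟨j, hj, rfl⟩ <;>
        simp only [Rect.area, *] at harea
        any_goals omega
        · exact hrs rfl
        · exact hrs rfl
        · have hij : i ≠ j := by rintro rfl; exact hrs rfl
          rcases hc with ⟨-, h⟩ | ⟨h, -⟩
          · simp only at h
            rcases lt_or_gt_of_ne hij with h' | h'
            · have := hHmono j hj i h'
              omega
            · have := hHmono i hi j h'
              omega
          · simp only at h
            have h3 := haA i hi
            rw [h] at h3
            have := Nat.mul_le_mul (hHge j hj) (hHge i hi)
            omega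
        · exact hright_top i hi j hj hc
        · exact hright_top j hj i hi hc.symm
        · have hij : i ≠ j := by rintro rfl; exact hrs rfl
          rcases hc with ⟨h, -⟩ | ⟨h, -⟩
          · simp only at h
            rcases lt_or_gt_of_ne hij with h' | h'
            · have := hWmono (j + 1) (by omega) (i + 1) (by omega)
              omega
            · have := hWmono (i + 1) (by omega) (j + 1) (by omega)
              omega
          · simp only at h
            have h3 := hbA j hj
            rw [← h] at h3
            have := Nat.mul_le_mul (hWge (j + 1) (by omega)) (hWge (i + 1) (by omega))
            omega }
  have hcard : 2 ≤ P.rects.card := by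
    refine Finset.one_lt_card.2 ⟨_, (hmem _).2 (Or.inl rfl), _, (hmem _).2 (Or.inr (Or.inl rfl)), ?_⟩
    simp only [ne_eq, Rect.mk.injEq, not_and]
    omega
  have hdefect : P.defect ≤ D := by
    refine Finset.sup_le fun r hr => Finset.sup_le fun s hs => ?_
    have h1 := hareas r hr
    have h2 := hareas s hs
    omega
  have hle : mondrianD n ≤ P.defect := Nat.sInf_le ⟨P, hcard, rfl⟩
  exact hle.trans hdefect

open Nat in
theorem doubleFactorial_dvd_add_two_mul (a k : ℕ) : a‼ ∣ (a + 2 * k)‼ := by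
  induction k with
  | zero => simp
  | succ k ih =>
    rw [show a + 2 * (k + 1) = a + 2 * k + 2 by ring, doubleFactorial_add_two]
    exact ih.mul_left _

open Nat in
theorem odd_doubleFactorial_odd (k : ℕ) : Odd (2 * k + 1)‼ := by
  induction k with
  | zero => simp
  | succ k ih =>
    rw [show 2 * (k + 1) + 1 = 2 * k + 1 + 2 by ring, doubleFactorial_add_two]
    exact Odd.mul ⟨k + 1, by ring⟩ ih

open Nat in
theorem doubleFactorial_odd_mul_lt_sq (k : ℕ) :
    (2 * k + 3)‼ * (2 * k + 1)‼ < (2 * k + 2)‼ ^ 2 := by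
  induction k with
  | zero => decide
  | succ k ih =>
    have h3 : (2 * (k + 1) + 3)‼ = (2 * k + 5) * (2 * k + 3)‼ :=
      doubleFactorial_add_two (2 * k + 3)
    have h1 : (2 * (k + 1) + 1)‼ = (2 * k + 3) * (2 * k + 1)‼ :=
      doubleFactorial_add_two (2 * k + 1)
    have h2 : (2 * (k + 1) + 2)‼ = (2 * k + 4) * (2 * k + 2)‼ :=
      doubleFactorial_add_two (2 * k + 2)
    rw [h3, h1, h2]
    calc _ = ((2 * k + 5) * (2 * k + 3)) * ((2 * k + 3)‼ * (2 * k + 1)‼) := by ring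
      _ < ((2 * k + 4) ^ 2) * ((2 * k + 2)‼ ^ 2) :=
          Nat.mul_lt_mul_of_le_of_lt (by nlinarith) ih (by positivity)
      _ = _ := by ring

open Nat in
theorem succ_mul_sq_doubleFactorial_le (k : ℕ) :
    (k + 1) * (2 * k)‼ ^ 2 ≤ (2 * k + 1)‼ ^ 2 := by
  induction k with
  | zero => decide
  | succ k ih =>
    rw [show 2 * (k + 1) + 1 = 2 * k + 1 + 2 by ring, show 2 * (k + 1) = 2 * k + 2 by ring,
      doubleFactorial_add_two, doubleFactorial_add_two]
    have h : (k + 2) * (2 * k + 2) ^ 2 ≤ (2 * k + 3) ^ 2 * (k + 1) := by nlinarith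
    calc _ = ((k + 2) * (2 * k + 2) ^ 2) * (2 * k)‼ ^ 2 := by ring
      _ ≤ ((2 * k + 3) ^ 2 * (k + 1)) * (2 * k)‼ ^ 2 := Nat.mul_le_mul_right _ h
      _ = (2 * k + 3) ^ 2 * ((k + 1) * (2 * k)‼ ^ 2) := by ring
      _ ≤ (2 * k + 3) ^ 2 * (2 * k + 1)‼ ^ 2 := Nat.mul_le_mul_left _ ih
      _ = _ := by ring

open Nat in
theorem factorial_half_eq (m : ℕ) :
    (2 * (m + 1) + 1)! / 2 = (m + 1) * (2 * m)‼ * (2 * m + 3)‼ := by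
  rw [factorial_eq_mul_doubleFactorial, show 2 * (m + 1) + 1 = 2 * m + 3 by ring,
    show 2 * (m + 1) = 2 * m + 2 by ring, doubleFactorial_add_two (2 * m)]
  refine Nat.div_eq_of_eq_mul_right two_pos ?_
  ring

open Nat in
theorem mondrianD_factorial_half_le (m : ℕ) :
    mondrianD ((2 * (m + 1) + 1)! / 2) ≤ (2 * (m + 1))‼ ^ 2 := by
  rw [factorial_half_eq]
  set C := (m + 1) * (2 * m)‼ with hC
  set O := (2 * m + 3)‼ with hO
  set P := (2 * m + 1)‼ with hP
  set E := (2 * (m + 1))‼ with hE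
  have hEC : E = 2 * C := by
    rw [hE, hC, show 2 * (m + 1) = 2 * m + 2 by ring, doubleFactorial_add_two]
    ring
  have hOP : O = (2 * m + 3) * P := doubleFactorial_add_two (2 * m + 1)
  have hE2 (j : ℕ) : (2 * (j + 1))‼ = 2 * (j + 1) * (2 * j)‼ := by
    rw [show 2 * (j + 1) = 2 * j + 2 by ring, doubleFactorial_add_two]
  have hO2 (j : ℕ) : (2 * (j + 1) + 1)‼ = (2 * j + 3) * (2 * j + 1)‼ :=
    doubleFactorial_add_two (2 * j + 1)
  have hepos (j : ℕ) : 0 < (2 * j)‼ := doubleFactorial_pos _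
  have hopos (j : ℕ) : 0 < (2 * j + 1)‼ := doubleFactorial_pos _
  have hCpos : 0 < C := Nat.mul_pos (succ_pos m) (hepos m)
  have hPpos : 0 < P := hopos m
  have hOpos : 0 < O := doubleFactorial_pos _
  have hOodd : Odd O := odd_doubleFactorial_odd (m + 1)
  have hPodd : Odd P := odd_doubleFactorial_odd m
  obtain ⟨f, hf⟩ : ∃ f : ℕ → ℕ, ∀ j ≤ m + 1, (2 * j)‼ * f j = E :=
    ⟨fun j => E / (2 * j)‼, fun j hj => Nat.mul_div_cancel' <| by
      obtain ⟨k, hk⟩ := Nat.exists_eq_add_of_le hj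
      rw [hE, hk, mul_add]
      exact doubleFactorial_dvd_add_two_mul _ _⟩
  obtain ⟨g, hg⟩ : ∃ g : ℕ → ℕ, ∀ j ≤ m + 1, (2 * j + 1)‼ * g j = O :=
    ⟨fun j => O / (2 * j + 1)‼, fun j hj => Nat.mul_div_cancel' <| by
      obtain ⟨k, hk⟩ := Nat.exists_eq_add_of_le hj
      rw [hO, show 2 * m + 3 = 2 * j + 1 + 2 * k by omega]
      exact doubleFactorial_dvd_add_two_mul _ _⟩
  have hfpos (j : ℕ) (hj : j ≤ m + 1) : 0 < f j :=
    Nat.pos_of_mul_pos_left (a := (2 * j)‼) (by rw [hf j hj]; omega)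
  have hgpos (j : ℕ) (hj : j ≤ m + 1) : 0 < g j :=
    Nat.pos_of_mul_pos_left (a := (2 * j + 1)‼) (by rw [hg j hj]; exact hOpos)
  have hfs (j : ℕ) (hj : j ≤ m) : f j = 2 * (j + 1) * f (j + 1) := by
    refine Nat.eq_of_mul_eq_mul_left (hepos j) ?_
    rw [hf j (by omega), ← hf (j + 1) (by omega), hE2]
    ring
  have hgs (j : ℕ) (hj : j ≤ m) : g j = (2 * j + 3) * g (j + 1) := by
    refine Nat.eq_of_mul_eq_mul_left (hopos j) ?_
    rw [hg j (by omega), ← hg (j + 1) (by omega), hO2]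
    ring
  have hfC (j : ℕ) (hj : j ≤ m) : (j + 1) * (2 * j)‼ * f (j + 1) = C := by
    have h := hf (j + 1) (by omega)
    rw [hE2, hEC] at h
    linarith
  have hf0 : f 0 = 2 * C := by simpa [hEC] using hf 0 (by omega)
  have hg0 : g 0 = O := by simpa using hg 0 (by omega)
  obtain ⟨k, hk⟩ : Odd (O * P) := hOodd.mul hPodd
  have hkpos : 0 < k := by
    have : 3 * 1 ≤ O * P := Nat.mul_le_mul (by rw [hOP]; nlinarith) hPpos
    omega
  have hlow : O * P < 4 * C ^ 2 := by
    have h : O * P < E ^ 2 := doubleFactorial_odd_mul_lt_sq m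
    rw [hEC] at h
    linarith
  have hupp : C ^ 2 < O * P := by
    have h : (m + 1 + 1) * E ^ 2 ≤ O ^ 2 := succ_mul_sq_doubleFactorial_le (m + 1)
    rw [hEC] at h
    have h' : (2 * m + 3) * C ^ 2 < (2 * m + 3) * (O * P) := by
      have : (2 * m + 3) * (O * P) = O ^ 2 := by rw [hOP]; ring
      rw [this]
      nlinarith [Nat.pow_pos (n := 2) hCpos]
    exact Nat.lt_of_mul_lt_mul_left h'
  refine exists_mondrian_of_staircase
    (W := fun j => f j * C * (2 * j + 1)‼) (H := fun j => g j * P * ((j + 1) * (2 * j)‼))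
    (a := fun j => f (j + 1) * C * (2 * j + 1)‼)
    (b := fun j => g (j + 1) * P * ((j + 1) * (2 * j)‼)) (m := m) (p := k + 1) (q := k)
    (A := C ^ 2 * (O * P)) ?_ hkpos ?_ ?_ ?_ ?_ ?_ ?_ ?_ ?_ ?_ ?_ ?_ ?_ ?_ ?_ ?_
  · exact Nat.mul_pos (Nat.mul_pos (hfpos 0 (by omega)) hCpos) (hopos 0)
  · simp [hg0]
    omega
  · exact fun j hj => Nat.mul_pos (Nat.mul_pos (hfpos _ (by omega)) hCpos) (hopos j)
  · exact fun j hj => Nat.mul_pos (Nat.mul_pos (hgpos _ (by omega)) hPpos)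
      (Nat.mul_pos (succ_pos j) (hepos j))
  · intro j hj
    simp only [hO2, hfs j hj]
    ring
  · intro j hj
    simp only [hE2, hgs j hj.le]
    ring
  · have h : f (m + 1) = 1 :=
      Nat.eq_of_mul_eq_mul_left (hepos (m + 1)) (by rw [hf _ le_rfl, mul_one])
    simp only [h, one_mul]
    rfl
  · have h : g (m + 1) = 1 :=
      Nat.eq_of_mul_eq_mul_left (hopos (m + 1)) (by rw [hg _ le_rfl, mul_one]; rfl)
    simp only [hgs m le_rfl, h, hOP, ← hC]
    ring
  · intro j hj
    calc _ = ((j + 1) * (2 * j)‼ * f (j + 1)) * C * (((2 * j + 1)‼ * g j) * P) := by ring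
      _ = _ := by rw [hfC j hj, hg j (by omega)]; ring
  · intro j hj
    calc _ = ((j + 1) * (2 * j)‼ * f (j + 1)) * C * (((2 * (j + 1) + 1)‼ * g (j + 1)) * P) := by
          ring
      _ = _ := by rw [hfC j hj.le, hg (j + 1) (by omega)]; ring
  · simp only [hf0, hk, doubleFactorial, mul_one]
    nlinarith [Nat.pow_pos (n := 2) hCpos]
  · simp only [hf0, hk, doubleFactorial, mul_one]
    nlinarith [Nat.pow_pos (n := 2) hCpos]
  · simp only [hf0, hEC, doubleFactorial, mul_one]
    rw [← Nat.mul_sub, Nat.add_sub_cancel_left]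
    nlinarith
  · simp only [hf0, doubleFactorial, mul_one]
    nlinarith [Nat.mul_lt_mul_of_pos_left hlow (Nat.pow_pos (n := 2) hCpos)]
  · simp only [hg0, doubleFactorial, zero_add, mul_one]
    exact Nat.mul_lt_mul_of_pos_right hupp (Nat.mul_pos hOpos hPpos)
  · intro i hi j hj h
    simp only [hfs (i + 1) hi] at h
    have hgodd : Odd (g j) := by
      rw [← hg j (by omega)] at hOodd
      exact (Nat.odd_mul.1 hOodd).2
    have hpos : 0 < (j + 1) * (2 * j)‼ := Nat.mul_pos (succ_pos j) (hepos j)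
    rw [← hfC j hj] at h
    have h' : g j * P = 2 * ((i + 1 + 1) * f (i + 1 + 1) * f (j + 1) * (2 * (i + 1) + 1)‼) := by
      refine Nat.eq_of_mul_eq_mul_right hpos ?_
      rw [← h]
      ring
    exact Nat.not_even_iff_odd.2 (hgodd.mul hPodd) (even_iff_two_dvd.2 ⟨_, h'⟩)

open Nat in
theorem mondrianRho_factorial_half_le (m : ℕ) :
    mondrianRho ((2 * (m + 1) + 1)! / 2) ≤
      (2 * ((2 * (m + 1))‼ : ℝ) / ((2 * (m + 1) + 1)! : ℝ)) ^ 2 := by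
  have hcast : (((2 * (m + 1) + 1)! / 2 : ℕ) : ℝ) = ((2 * (m + 1) + 1)! : ℝ) / 2 := by
    rw [Nat.cast_div_charZero (Nat.dvd_factorial two_pos (by omega)), Nat.cast_ofNat]
  have hD : (mondrianD ((2 * (m + 1) + 1)! / 2) : ℝ) ≤ ((2 * (m + 1))‼ : ℝ) ^ 2 := by
    exact_mod_cast mondrianD_factorial_half_le m
  unfold mondrianRho
  rw [hcast]
  calc _ ≤ ((2 * (m + 1))‼ : ℝ) ^ 2 / (((2 * (m + 1) + 1)! : ℝ) / 2) ^ 2 := by gcongr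
    _ = _ := by field_simp

open Nat in
theorem two_mul_doubleFactorial_div_factorial_le (r : ℕ) :
    2 * ((2 * r)‼ : ℝ) / ((2 * r + 1)! : ℝ) ≤ 2 / ((r : ℝ) + 1) := by
  have h1 : ((2 * r + 1)! : ℝ) = ((2 * r + 1)‼ : ℝ) * ((2 * r)‼ : ℝ) := by
    exact_mod_cast factorial_eq_mul_doubleFactorial (2 * r)
  have h2 : (0 : ℝ) < ((2 * r)‼ : ℝ) := by exact_mod_cast doubleFactorial_pos _
  have h3 : r + 1 ≤ (2 * r + 1)‼ := by
    rcases r with _ | r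
    · simp
    · rw [show 2 * (r + 1) + 1 = 2 * r + 1 + 2 by ring, doubleFactorial_add_two]
      nlinarith [doubleFactorial_pos (2 * r + 1)]
  have h4 : (r : ℝ) + 1 ≤ ((2 * r + 1)‼ : ℝ) := by exact_mod_cast h3
  rw [h1, mul_div_mul_right _ _ h2.ne']
  gcongr

/-- Along the sequence `n_r = (2r+1)!/2`, the defect ratio satisfies
`ρ(n_r) ≤ (2·(2r)!!/(2r+1)!)²` for all `r ≥ 3` and tends to `0`. -/
theorem rho_tendsto_zero :
    (∀ r : ℕ, 3 ≤ r →
      mondrianRho ((2 * r + 1).factorial / 2) ≤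
        (2 * (Nat.doubleFactorial (2 * r) : ℝ) / ((2 * r + 1).factorial : ℝ)) ^ 2) ∧
    Filter.Tendsto (fun r : ℕ => mondrianRho ((2 * r + 1).factorial / 2))
      Filter.atTop (nhds 0) := by
  have hle : ∀ r : ℕ, 3 ≤ r →
      mondrianRho ((2 * r + 1).factorial / 2) ≤
        (2 * (Nat.doubleFactorial (2 * r) : ℝ) / ((2 * r + 1).factorial : ℝ)) ^ 2 := by
    intro r hr
    obtain ⟨m, rfl⟩ : ∃ m, r = m + 1 := ⟨r - 1, by omega⟩
    exact mondrianRho_factorial_half_le m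
  refine ⟨hle, ?_⟩
  have hlim : Filter.Tendsto (fun r : ℕ => (2 / ((r : ℝ) + 1)) ^ 2) Filter.atTop (nhds 0) := by
    have h := (tendsto_one_div_add_atTop_nhds_zero_nat (𝕜 := ℝ)).const_mul 2 |>.pow 2
    simpa [div_eq_mul_inv] using h
  refine squeeze_zero' (Filter.Eventually.of_forall fun r => ?_) ?_ hlim
  · unfold mondrianRho
    positivity
  · filter_upwards [Filter.eventually_ge_atTop 3] with r hr
    refine (hle r hr).trans ?_
    exact pow_le_pow_left₀ (by positivity) (two_mul_doubleFactorial_div_factorial_le r) 2
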